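/- arXiv:0902.0567 — 2 statements merged into one kernel-verified Lean document; each statement's English description precedes it below -/
import Mathlib

section
/- Let E be an additive abelian group and S ⊆ E with 0 ∈ S and S = −S. Let n ≥ 1 and assume that every element of E is a sum of n elements of S. Then for every integer N > 2n+1 one has 𝒵_N ⊆ 𝒵_{2n+1} · 𝒵_{N−1}: every κ ∈ 𝒵 of reduced length at most N can be written as a product κ = κ_1 κ_2 in 𝒵 with len(κ_1) ≤ 2n+1 and len(κ_2) ≤ N−1. -/
noncomputable section
open scoped BigOperators

/-- One elementary move on finite tuples (modelled as lists) of elements of an additive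
group: permuting the entries, inserting a pair of entries `k, -k` with `k ∈ S`, or
inserting an entry `0`. -/
inductive CycleMove {E : Type*} [AddCommGroup E] (S : Set E) : List E → List E → Prop
  | perm {l l' : List E} (h : l.Perm l') : CycleMove S l l'
  | pair (k : E) (hk : k ∈ S) (l : List E) : CycleMove S l (k :: -k :: l)
  | zero (l : List E) : CycleMove S l ((0 : E) :: l)

/-- The equivalence relation `∼`: two tuples are equivalent iff one can be obtained from
the other by a finite sequence of elementary moves (permutations, insertion or deletion
of a pair `k, -k` with `k ∈ S`, insertion or deletion of an entry `0`). -/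
def CycleEquiv {E : Type*} [AddCommGroup E] (S : Set E) : List E → List E → Prop :=
  Relation.EqvGen (CycleMove S)

/-- A cycle: a finite tuple of elements of `S` whose sum is `0`. -/
def IsCycle {E : Type*} [AddCommGroup E] (S : Set E) (l : List E) : Prop :=
  (∀ x ∈ l, x ∈ S) ∧ l.sum = 0

section CycleEquiv

variable {E : Type*} [AddCommGroup E] {S : Set E}

lemma CycleMove.isCycle_iff (h0S : (0 : E) ∈ S) (hSneg : ∀ k ∈ S, -k ∈ S) {l l' : List E}
    (h : CycleMove S l l') : IsCycle S l ↔ IsCycle S l' := by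
  cases h with
  | perm h => simp only [IsCycle, h.mem_iff, h.sum_eq]
  | pair k hk l => simp [IsCycle, hk, hSneg k hk]
  | zero l => simp [IsCycle, h0S]

lemma CycleEquiv.isCycle_iff (h0S : (0 : E) ∈ S) (hSneg : ∀ k ∈ S, -k ∈ S) {l l' : List E}
    (h : CycleEquiv S l l') : IsCycle S l ↔ IsCycle S l' := by
  induction h with
  | rel _ _ h => exact h.isCycle_iff h0S hSneg
  | refl _ => exact Iff.rfl
  | symm _ _ _ ih => exact ih.symm
  | trans _ _ _ _ _ ih₁ ih₂ => exact ih₁.trans ih₂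

lemma List.Perm.cycleEquiv {l l' : List E} (h : l.Perm l') : CycleEquiv S l l' :=
  .rel _ _ (.perm h)

lemma CycleEquiv.append_neg_append (c l : List E) (hc : ∀ x ∈ c, x ∈ S) :
    CycleEquiv S l (c ++ (c.map (-·) ++ l)) := by
  induction c with
  | nil => exact .refl _
  | cons k c ih =>
    rw [List.forall_mem_cons] at hc
    refine .trans _ _ _ (ih hc.2) (.trans _ _ _ (.rel _ _ (.pair k hc.1 _)) ?_)
    exact List.Perm.cycleEquiv (List.perm_middle.symm.cons k)

end CycleEquiv

/-- **Statement 13.** If every element of `E` is a sum of `n` elements of `S`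
(`0 ∈ S = -S`), then for every `N > 2n+1` one has `𝒵_N ⊆ 𝒵_{2n+1} ⬝ 𝒵_{N-1}`: every
cycle class of reduced length at most `N` is the product (concatenation) of a cycle
class of reduced length at most `2n+1` and one of reduced length at most `N-1`. -/
theorem statement13 {E : Type*} [AddCommGroup E] (S : Set E)
    (h0S : (0 : E) ∈ S) (hSneg : ∀ k ∈ S, -k ∈ S)
    (n : ℕ) (hn : 1 ≤ n)
    (hgen : ∀ x : E, ∃ c : Fin n → E, (∀ i, c i ∈ S) ∧ ∑ i, c i = x)
    (N : ℕ) (hN : 2 * n + 1 < N)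
    (l : List E) (hl : IsCycle S l)
    (hlen : ∃ l' : List E, CycleEquiv S l l' ∧ l'.length ≤ N) :
    ∃ l₁ l₂ : List E, IsCycle S l₁ ∧ IsCycle S l₂ ∧
      l₁.length ≤ 2 * n + 1 ∧ l₂.length ≤ N - 1 ∧
      CycleEquiv S l (l₁ ++ l₂) := by
  obtain ⟨l', hll', hl'N⟩ := hlen
  obtain ⟨hmem, hsum⟩ := (hll'.isCycle_iff h0S hSneg).1 hl
  obtain ⟨c, hcS, hcsum⟩ := hgen (l'.take (n + 1)).sum
  have hcS' : ∀ x ∈ List.ofFn c, x ∈ S := List.forall_mem_ofFn_iff.2 hcS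
  have hcsum' : (List.ofFn c).sum = (l'.take (n + 1)).sum := by rw [List.sum_ofFn, hcsum]
  have hlen_c : (List.ofFn c).length = n := List.length_ofFn
  generalize List.ofFn c = d at hcS' hcsum' hlen_c
  refine ⟨l'.take (n + 1) ++ d.map (-·), d ++ l'.drop (n + 1), ⟨?_, ?_⟩, ⟨?_, ?_⟩, ?_, ?_, ?_⟩
  · intro x hx
    rcases List.mem_append.1 hx with hx | hx
    · exact hmem x (List.mem_of_mem_take hx)
    · obtain ⟨y, hy, rfl⟩ := List.mem_map.1 hx
      exact hSneg y (hcS' y hy)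
  · rw [List.sum_append, ← hcsum', ← List.sum_neg, add_neg_cancel]
  · intro x hx
    rcases List.mem_append.1 hx with hx | hx
    · exact hcS' x hx
    · exact hmem x (List.mem_of_mem_drop hx)
  · rw [List.sum_append, hcsum', List.sum_take_add_sum_drop, hsum]
  · simp only [List.length_append, List.length_take, List.length_map]
    omega
  · simp only [List.length_append, List.length_drop]
    omega
  · refine .trans _ _ _ hll' (.trans _ _ _ (CycleEquiv.append_neg_append d l' hcS') ?_)
    refine List.Perm.cycleEquiv (Multiset.coe_eq_coe.1 ?_)
    conv_lhs => rw [← List.take_append_drop (n + 1) l']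
    simp only [← Multiset.coe_add]
    abel
end
end

section
/- (Theorem main) Let E be an additive abelian group and S ⊆ E with 0 ∈ S and S = −S. Let n ≥ 1 and assume that every element of E is a sum of n elements of S (i.e. S + ⋯ + S, with n summands, equals E). Then 𝒵 is generated, as a group, by 𝒵_{2n+1}: every element of 𝒵 is a finite product of elements of reduced length at most 2n+1. -/
noncomputable section
open scoped BigOperators

namespace CycleEquiv

variable {E : Type*} [AddCommGroup E] {S : Set E}

lemma refl (l : List E) : CycleEquiv S l l := Relation.EqvGen.refl l

lemma symm {l l' : List E} (h : CycleEquiv S l l') : CycleEquiv S l' l :=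
  Relation.EqvGen.symm _ _ h

lemma trans {l l' l'' : List E} (h : CycleEquiv S l l') (h' : CycleEquiv S l' l'') :
    CycleEquiv S l l'' :=
  Relation.EqvGen.trans _ _ _ h h'

lemma of_perm {l l' : List E} (h : l.Perm l') : CycleEquiv S l l' :=
  Relation.EqvGen.rel _ _ (.perm h)

lemma cons (a : E) {l l' : List E} (h : CycleEquiv S l l') :
    CycleEquiv S (a :: l) (a :: l') := by
  induction h with
  | rel x y h =>
    cases h with
    | perm h => exact of_perm (h.cons a)
    | pair k hk =>
      exact trans (Relation.EqvGen.rel _ _ (.pair k hk (a :: x)))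
        (of_perm (List.perm_middle (l₁ := [k, -k]) (l₂ := x)))
    | zero =>
      exact trans (Relation.EqvGen.rel _ _ (.zero (a :: x))) (of_perm (List.Perm.swap _ _ _))
  | refl x => exact refl _
  | symm x y _ ih => exact ih.symm
  | trans x y z _ _ ih ih' => exact ih.trans ih'

lemma append_left (a : List E) {l l' : List E} (h : CycleEquiv S l l') :
    CycleEquiv S (a ++ l) (a ++ l') := by
  induction a with
  | nil => exact h
  | cons x a ih => exact cons x ih

/-- A tuple of elements of `S` followed by its entrywise negative can be inserted. -/
lemma append_neg (r l : List E) (hr : ∀ x ∈ r, x ∈ S) :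
    CycleEquiv S l (l ++ (r ++ r.map (-·))) := by
  induction r with
  | nil => simpa using refl l
  | cons k r ih =>
    refine trans (ih fun x hx => hr x (by simp [hx]))
      (trans (Relation.EqvGen.rel _ _ (CycleMove.pair k (hr k (by simp)) _)) (of_perm ?_))
    rw [← Multiset.coe_eq_coe]
    simp only [← Multiset.coe_add, ← Multiset.cons_coe, List.map_cons, List.cons_append,
      ← Multiset.singleton_add]
    abel

/-- Given a section `r` of the sum map on tuples of length `n` over `S`, a tuple `l` over `S`
decomposes into cycles of length at most `2 * n + 1`, up to the representatives of its
end points. -/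
lemma exists_telescope {n : ℕ} (hSneg : ∀ k ∈ S, -k ∈ S) (r : E → List E)
    (hrS : ∀ s, ∀ x ∈ r s, x ∈ S) (hrl : ∀ s, (r s).length = n) (hrs : ∀ s, (r s).sum = s)
    (l : List E) (hl : ∀ x ∈ l, x ∈ S) (s : E) :
    ∃ L : List (List E), (∀ q ∈ L, IsCycle S q ∧ q.length ≤ 2 * n + 1) ∧
      CycleEquiv S (r s ++ l) (L.flatten ++ r (s + l.sum)) := by
  induction l generalizing s with
  | nil => exact ⟨[], by simp, by simpa using refl (r s)⟩
  | cons k t ih =>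
    obtain ⟨L, hL, hLe⟩ := ih (fun x hx => hl x (by simp [hx])) (s + k)
    have hneg : ((r (s + k)).map (-·)).sum = -(s + k) := by
      rw [← List.sum_neg, hrs]
    refine ⟨(r s ++ k :: (r (s + k)).map (-·)) :: L, ?_, ?_⟩
    · intro q hq
      rcases List.mem_cons.1 hq with rfl | hq
      · refine ⟨⟨?_, ?_⟩, ?_⟩
        · intro x hx
          simp only [List.mem_append, List.mem_cons, List.mem_map] at hx
          rcases hx with hx | rfl | ⟨y, hy, rfl⟩
          · exact hrS _ _ hx
          · exact hl _ (by simp)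
          · exact hSneg _ (hrS _ _ hy)
        · rw [List.sum_append, List.sum_cons, hneg, hrs]
          abel
        · simp only [List.length_append, List.length_cons, List.length_map, hrl]
          omega
      · exact hL q hq
    · have h := append_left (r s ++ k :: (r (s + k)).map (-·)) hLe
      rw [← List.append_assoc _ L.flatten, ← List.flatten_cons, add_assoc, ← List.sum_cons] at h
      refine ((append_neg (r (s + k)) (r s ++ k :: t) (hrS _)).trans (of_perm ?_)).trans h
      rw [← Multiset.coe_eq_coe]
      simp only [← Multiset.coe_add, ← Multiset.cons_coe, ← Multiset.singleton_add]
      abel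

end CycleEquiv

/-- **Statement 14 (Theorem main).** If every element of `E` is a sum of `n` elements of
`S` (`0 ∈ S = -S`), then `𝒵` is generated, as a group, by `𝒵_{2n+1}`: every cycle class
is a finite product of classes of cycles of length at most `2n+1`. -/
theorem statement14 {E : Type*} [AddCommGroup E] (S : Set E)
    (h0S : (0 : E) ∈ S) (hSneg : ∀ k ∈ S, -k ∈ S)
    (n : ℕ) (hn : 1 ≤ n)
    (hgen : ∀ x : E, ∃ c : Fin n → E, (∀ i, c i ∈ S) ∧ ∑ i, c i = x)
    (l : List E) (hl : IsCycle S l) :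
    ∃ (m : ℕ) (c : Fin m → List E),
      (∀ i, IsCycle S (c i) ∧ (c i).length ≤ 2 * n + 1) ∧
      CycleEquiv S l (List.ofFn c).flatten := by
  choose c hcS hcs using hgen
  set r : E → List E := fun x => List.ofFn (c x) with hr
  have hrS : ∀ s, ∀ x ∈ r s, x ∈ S := by
    intro s x hx
    obtain ⟨i, rfl⟩ := (List.mem_ofFn' _ _).1 hx
    exact hcS s i
  obtain ⟨L, hL, hLe⟩ := CycleEquiv.exists_telescope (n := n) hSneg r hrS (fun s => by simp [hr])
    (fun s => by simp [hr, List.sum_ofFn, hcs]) l hl.1 0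
  rw [hl.2, add_zero] at hLe
  refine ⟨L.length, L.get, fun i => hL _ (L.get_mem i), ?_⟩
  rw [List.ofFn_get]
  have h := CycleEquiv.append_left ((r 0).map (-·)) hLe
  refine (CycleEquiv.append_neg (r 0) l (hrS 0)).trans <| (CycleEquiv.of_perm ?_).trans <|
    h.trans <| (CycleEquiv.of_perm ?_).trans (CycleEquiv.append_neg (r 0) _ (hrS 0)).symm
  all_goals
    rw [← Multiset.coe_eq_coe]
    simp only [← Multiset.coe_add]
    abel
end
end
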